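/- Let r ≥ 2, let n = kr+1 for some integer k ≥ 1, and let c : [n] → {1,...,r} be a map such that c(i) ≠ c(j) whenever {i,j} is a 2-element subset of [n] that is not r-stable. Then for all integers j with 1 ≤ j ≤ r and l with 0 ≤ l ≤ k−1 (and lr+j ≤ n), one has c(lr+j) = c(j); in particular c(n) = c(kr+1) = c(1). -/

import Mathlib

open Classical

/-- A subset `σ ⊆ [n]` is `r`-stable if `r ≤ |i - j| ≤ n - r` for all distinct `i, j ∈ σ`. -/
def rStable (n r : ℕ) (σ : Finset ℕ) : Prop :=
  ∀ i ∈ σ, ∀ j ∈ σ, i < j → r ≤ j - i ∧ j - i ≤ n - r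

/-- A subset `σ ⊆ [n]` is almost `r`-stable if `|i - j| ≥ r` for all distinct `i, j ∈ σ`. -/
def almostRStable (r : ℕ) (σ : Finset ℕ) : Prop :=
  ∀ i ∈ σ, ∀ j ∈ σ, i < j → r ≤ j - i

/-- `F(n,r)`: all 2-element subsets of `[n] = {1, ..., n}` that are not `r`-stable. -/
def Fnr (n r : ℕ) : Set (Finset ℕ) :=
  {σ | σ ⊆ Finset.Icc 1 n ∧ σ.card = 2 ∧ ¬ rStable n r σ}

/-- The hypergraph with vertex set `V` and edge set `E` admits a proper `m`-coloring
(colors `{1, ..., m}`, no monochromatic edge). -/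
def Colorable (V : Finset ℕ) (E : Set (Finset ℕ)) (m : ℕ) : Prop :=
  ∃ c : ℕ → ℕ, (∀ v ∈ V, c v ∈ Finset.Icc 1 m) ∧
    ∀ e ∈ E, ∃ i ∈ e, ∃ j ∈ e, c i ≠ c j

/-- The `r`-colorability defect of the hypergraph `(V, E)`: the minimum number of vertices
to delete so that the induced hypergraph on the remaining vertices is `r`-colorable. -/
noncomputable def cd (r : ℕ) (V : Finset ℕ) (E : Set (Finset ℕ)) : ℕ :=
  sInf {b | ∃ B : Finset ℕ, B ⊆ V ∧ B.card = b ∧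
    Colorable (V \ B) {e ∈ E | e ⊆ V \ B} r}

/-- `KG^r(F)` admits a proper `m`-coloring: a map `c` on the members of `F` with colors in
`{1, ..., m}` such that no `r`-element set of pairwise disjoint members of `F` is
monochromatic. -/
def KGColorable (r : ℕ) (F : Set (Finset ℕ)) (m : ℕ) : Prop :=
  ∃ c : Finset ℕ → ℕ, (∀ A ∈ F, c A ∈ Finset.Icc 1 m) ∧
    ∀ E : Finset (Finset ℕ), E.card = r → ↑E ⊆ F →
      (∀ A ∈ E, ∀ B ∈ E, A ≠ B → Disjoint A B) →
      ∃ A ∈ E, ∃ B ∈ E, c A ≠ c B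

/-- The chromatic number of the Kneser hypergraph `KG^r(F)`. -/
noncomputable def chiKG (r : ℕ) (F : Set (Finset ℕ)) : ℕ :=
  sInf {m | KGColorable r F m}

/-- The `r`-stable members of a set system `F` on `[n]`. -/
def rStabPart (n r : ℕ) (F : Set (Finset ℕ)) : Set (Finset ℕ) :=
  {σ ∈ F | rStable n r σ}

/-- The almost `r`-stable members of a set system `F`. -/
def almostStabPart (r : ℕ) (F : Set (Finset ℕ)) : Set (Finset ℕ) :=
  {σ ∈ F | almostRStable r σ}

/-- The extra family `G = {{1+ir, 1+(i+1)r} : i = 0, ..., 2r-3} ∪ {{(2r-2)r+1, 1}}`. -/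
def Gfam (r : ℕ) : Set (Finset ℕ) :=
  {σ | ∃ i, i ≤ 2 * r - 3 ∧ σ = ({1 + i * r, 1 + (i + 1) * r} : Finset ℕ)} ∪
    {({(2 * r - 2) * r + 1, 1} : Finset ℕ)}

/-- If nearby points of `[n]` get distinct colors out of `r`, then the coloring is
`r`-periodic. -/
theorem color_add_eq {n r : ℕ} (hr : 1 ≤ r) {c : ℕ → ℕ}
    (hc : ∀ v ∈ Finset.Icc 1 n, c v ∈ Finset.Icc 1 r)
    (hne : ∀ i j, 1 ≤ i → i < j → j ≤ n → j < i + r → c i ≠ c j)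
    {i : ℕ} (hi : 1 ≤ i) (hin : i + r ≤ n) : c (i + r) = c i := by
  have hinj : Set.InjOn c (Finset.Ico i (i + r)) := by
    intro a ha b hb hab
    simp only [Finset.coe_Ico, Set.mem_Ico] at ha hb
    rcases lt_trichotomy a b with h | h | h
    · exact absurd hab (hne a b (by omega) h (by omega) (by omega))
    · exact h
    · exact absurd hab.symm (hne b a (by omega) h (by omega) (by omega))
  have himage : (Finset.Ico i (i + r)).image c = Finset.Icc 1 r := by
    apply Finset.eq_of_subset_of_card_le
    · intro x hx
      obtain ⟨a, ha, rfl⟩ := Finset.mem_image.1 hx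
      rw [Finset.mem_Ico] at ha
      exact hc a (Finset.mem_Icc.2 ⟨by omega, by omega⟩)
    · rw [Finset.card_image_of_injOn hinj]
      simp
  have hmem := hc (i + r) (Finset.mem_Icc.2 ⟨by omega, hin⟩)
  rw [← himage] at hmem
  obtain ⟨a, ha, hac⟩ := Finset.mem_image.1 hmem
  rw [Finset.mem_Ico] at ha
  rcases ha.1.eq_or_lt with rfl | h
  · exact hac.symm
  · exact absurd hac (hne a (i + r) (by omega) ha.2 hin (by omega))

/-- For `r ≥ 2`, `n = kr + 1` with `k ≥ 1`, if `c : [n] → {1, ..., r}` gives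
distinct colors to the two elements of every non-`r`-stable pair, then `c (l*r + j) = c j`
for all `1 ≤ j ≤ r`, `0 ≤ l ≤ k - 1` with `l*r + j ≤ n`; in particular `c n = c 1`. -/
theorem stmt_3 (r k n : ℕ) (hr : 2 ≤ r) (hk : 1 ≤ k) (hn : n = k * r + 1)
    (c : ℕ → ℕ) (hc : ∀ v ∈ Finset.Icc 1 n, c v ∈ Finset.Icc 1 r)
    (hprop : ∀ i ∈ Finset.Icc 1 n, ∀ j ∈ Finset.Icc 1 n,
      i ≠ j → ¬ rStable n r ({i, j} : Finset ℕ) → c i ≠ c j) :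
    (∀ j, 1 ≤ j → j ≤ r → ∀ l, l ≤ k - 1 → l * r + j ≤ n → c (l * r + j) = c j) ∧
    c n = c 1 := by
  have hne : ∀ i j, 1 ≤ i → i < j → j ≤ n → j < i + r → c i ≠ c j := by
    intro i j hi hij hj hjr
    refine hprop i (Finset.mem_Icc.2 ⟨hi, by omega⟩) j (Finset.mem_Icc.2 ⟨by omega, hj⟩)
      hij.ne fun h => ?_
    have := (h i (by simp) j (by simp) hij).1
    omega
  have key : ∀ j, 1 ≤ j → ∀ l, l * r + j ≤ n → c (l * r + j) = c j := by
    intro j hj l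
    induction l with
    | zero => simp
    | succ l ih =>
      intro h
      have e : (l + 1) * r + j = l * r + j + r := by ring
      rw [e] at h ⊢
      rw [color_add_eq (by omega) hc hne (by omega) h, ih (by omega)]
  refine ⟨fun j hj _ l _ h => key j hj l h, ?_⟩
  rw [hn]
  exact key 1 le_rfl k hn.ge
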